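/- Let L be an arbitrary left ideal of R and M = R/L the quotient left R-module. With respect to the Γ-filtration FM of M induced by the Γ-grading filtration FR of R, there is an isomorphism of Γ-graded R-modules G(M) ≅ R/⟨HT(L)], where ⟨HT(L)] is the Γ-graded left ideal of R generated by HT(L) and the associated Γ-graded ring G(R) of R (with respect to its grading filtration) is canonically identified with R. -/

import Mathlib

/-!
STATEMENT 2.  Γ a totally ordered semigroup, R a Γ-graded K-algebra, L a left
ideal of R and M = R/L (presented by a surjective R-linear map q : R → M with
kernel L).  With respect to the Γ-filtration F_γM = (F_γR + L)/L = q(F_γR)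
induced by the Γ-grading filtration of R, the associated Γ-graded module G(M)
(axiomatised below; its G(R)-module structure is an R-module structure since
G(R) is canonically identified with R) satisfies G(M) ≅ R/⟨HT(L)] as Γ-graded
R-modules: there is a Γ-graded R-module epimorphism φ : R → G(M) whose kernel
is the graded left ideal ⟨HT(L)] of R generated by the head terms of L.
-/

open Function

universe u v w x

variable (K : Type u) [Field K] (Γ : Type v) [Semigroup Γ] [LinearOrder Γ]

variable {R : Type w} [Ring R] [Algebra K R]

/-- `ℛ` is a `Γ`-grading of the `K`-algebra `R`. -/
structure IsAlgGrading [DecidableEq Γ] (ℛ : Γ → Submodule K R) : Prop where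
  internal : DirectSum.IsInternal ℛ
  mul_mem : ∀ {γ₁ γ₂ : Γ} {x y : R}, x ∈ ℛ γ₁ → y ∈ ℛ γ₂ → x * y ∈ ℛ (γ₁ * γ₂)

/-- The Γ-grading filtration `F_γR = ⊕_{γ'≼γ} R_{γ'}` of `R`. -/
def gradeFil (ℛ : Γ → Submodule K R) (γ : Γ) : Submodule K R := ⨆ γ' ≤ γ, ℛ γ'

/-- `F*_γR = ⋃_{γ'≺γ} F_{γ'}R`. -/
def gradeFilStar (ℛ : Γ → Submodule K R) (γ : Γ) : Submodule K R := ⨆ γ' < γ, ℛ γ'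

/-- `IsHT ℛ f h γ` : `h` is the head term of `f`, of degree `γ`. -/
def IsHT (ℛ : Γ → Submodule K R) (f h : R) (γ : Γ) : Prop :=
  h ∈ ℛ γ ∧ h ≠ 0 ∧ f - h ∈ gradeFilStar K Γ ℛ γ

/-- The set of head terms of elements of `S`. -/
def HTset (ℛ : Γ → Submodule K R) (S : Set R) : Set R :=
  {h | ∃ f ∈ S, ∃ γ, IsHT K Γ ℛ f h γ}

variable (ℛ : Γ → Submodule K R)

/-- The induced Γ-filtration `F_γM = q(F_γR)` of `M = R/L`. -/
def quotModFil {M : Type x} [AddCommGroup M] [Module K M] [Module R M]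
    [IsScalarTower K R M] (q : R →ₗ[R] M) (γ : Γ) : Submodule K M :=
  (gradeFil K Γ ℛ γ).map (q.restrictScalars K)

/-- `F*_γM = ⋃_{γ'≺γ} F_{γ'}M`. -/
def quotModFilStar {M : Type x} [AddCommGroup M] [Module K M] [Module R M]
    [IsScalarTower K R M] (q : R →ₗ[R] M) (γ : Γ) : Submodule K M :=
  ⨆ γ' < γ, quotModFil K Γ ℛ q γ'

/-- Axiomatisation of the associated Γ-graded module `G(M)` of `M = R/L` with
respect to the induced filtration; `N` carries an `R`-module structure since
the associated graded ring `G(R)` of the graded ring `R` is canonically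
identified with `R` itself.  `σ γ : F_γM → G(M)` is the canonical map onto the
γ-component `G(M)_γ = F_γM/F*_γM`; the data determine `N` up to a canonical
isomorphism of Γ-graded R-modules. -/
structure AssocGradedQuotMod [DecidableEq Γ] {M : Type x} [AddCommGroup M] [Module K M]
    [Module R M] [IsScalarTower K R M] (q : R →ₗ[R] M)
    (N : Type*) [AddCommGroup N] [Module K N] [Module R N] [IsScalarTower K R N] where
  grade : Γ → Submodule K N
  internal : DirectSum.IsInternal grade
  σ : ∀ γ : Γ, (quotModFil K Γ ℛ q γ) →ₗ[K] N
  σ_mem : ∀ (γ : Γ) (m : quotModFil K Γ ℛ q γ), σ γ m ∈ grade γ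
  σ_surj : ∀ γ : Γ, ∀ y ∈ grade γ, ∃ m : quotModFil K Γ ℛ q γ, σ γ m = y
  σ_ker : ∀ (γ : Γ) (m : quotModFil K Γ ℛ q γ),
    σ γ m = 0 ↔ (m : M) ∈ quotModFilStar K Γ ℛ q γ
  /-- compatibility of the `R = G(R)`-action with the maps `σ`:
  for homogeneous `r ∈ R_{γ₁}` and `m ∈ F_{γ₂}M`, `r • σ_{γ₂}(m) = σ_{γ₁γ₂}(r • m)`. -/
  σ_smul : ∀ {γ₁ γ₂ : Γ} (r : R), r ∈ ℛ γ₁ → ∀ (m : quotModFil K Γ ℛ q γ₂)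
    (h : r • (m : M) ∈ quotModFil K Γ ℛ q (γ₁ * γ₂)),
    r • σ γ₂ m = σ (γ₁ * γ₂) ⟨r • (m : M), h⟩

section Helpers

variable {K Γ ℛ}

omit [Semigroup Γ] in
lemma le_gradeFil {γ' γ : Γ} (h : γ' ≤ γ) : ℛ γ' ≤ gradeFil K Γ ℛ γ :=
  le_iSup₂_of_le γ' h le_rfl

omit [Semigroup Γ] in
lemma gradeFil_eq_sup (γ : Γ) : gradeFil K Γ ℛ γ = ℛ γ ⊔ gradeFilStar K Γ ℛ γ := by
  refine le_antisymm (iSup₂_le fun γ' h => ?_)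
    (sup_le (le_gradeFil le_rfl) (iSup₂_le fun γ' h => le_gradeFil h.le))
  rcases h.lt_or_eq with h | rfl
  · exact le_sup_of_le_right (le_iSup₂_of_le γ' h le_rfl)
  · exact le_sup_left

omit [Semigroup Γ] in
lemma iSup_gradeFil_eq_gradeFilStar (γ : Γ) :
    ⨆ γ' < γ, gradeFil K Γ ℛ γ' = gradeFilStar K Γ ℛ γ :=
  le_antisymm
    (iSup₂_le fun _ h => iSup₂_le fun γ'' h' => le_iSup₂_of_le γ'' (h'.trans_lt h) le_rfl)
    (iSup₂_le fun γ' h => le_iSup₂_of_le γ' h (le_gradeFil le_rfl))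

omit [LinearOrder Γ] in
lemma IsAlgGrading.iSup_eq_top [DecidableEq Γ] (hgr : IsAlgGrading K Γ ℛ) : ⨆ γ, ℛ γ = ⊤ :=
  hgr.internal.submodule_iSup_eq_top

variable {M : Type x} [AddCommGroup M] [Module K M] [Module R M] [IsScalarTower K R M]
  {q : R →ₗ[R] M}

omit [Semigroup Γ] in
lemma quotModFilStar_eq_map (γ : Γ) :
    quotModFilStar K Γ ℛ q γ = (gradeFilStar K Γ ℛ γ).map (q.restrictScalars K) := by
  simp only [quotModFilStar, quotModFil, ← Submodule.map_iSup, iSup_gradeFil_eq_gradeFilStar]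

omit [Semigroup Γ] in
lemma apply_mem_quotModFil {γ : Γ} {r : R} (hr : r ∈ ℛ γ) : q r ∈ quotModFil K Γ ℛ q γ :=
  Submodule.mem_map_of_mem (f := q.restrictScalars K) (le_gradeFil le_rfl hr)

omit [Semigroup Γ] in
lemma mem_quotModFilStar_iff {L : Submodule R R} (hker : ∀ x : R, q x = 0 ↔ x ∈ L)
    {γ : Γ} {r : R} (hr : r ∈ ℛ γ) :
    q r ∈ quotModFilStar K Γ ℛ q γ ↔ r = 0 ∨ ∃ f ∈ L, IsHT K Γ ℛ f r γ := by
  rw [quotModFilStar_eq_map, Submodule.mem_map]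
  constructor
  · rintro ⟨g, hg, hgr⟩
    refine or_iff_not_imp_left.2 fun h0 => ?_
    have hL : r - g ∈ L := (hker _).1 (by simpa [sub_eq_zero] using hgr.symm)
    have hHT : IsHT K Γ ℛ (r - g) r γ := ⟨hr, h0, by simpa using neg_mem hg⟩
    exact ⟨_, hL, hHT⟩
  · rintro (rfl | ⟨f, hf, -, -, hfr⟩)
    · exact ⟨0, zero_mem _, rfl⟩
    · refine ⟨r - f, by simpa using neg_mem hfr, ?_⟩
      simp [(hker f).2 hf]

namespace AssocGradedQuotMod

variable [DecidableEq Γ] {N : Type*} [AddCommGroup N] [Module K N] [Module R N]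
  [IsScalarTower K R N] (GM : AssocGradedQuotMod K Γ ℛ q N)

/-- The map `R_γ → G(M)_γ` sending `r` to the class of `q r`. -/
def component (γ : Γ) : ℛ γ →ₗ[K] GM.grade γ :=
  (GM.σ γ ∘ₗ (q.restrictScalars K).restrict fun _ hr => apply_mem_quotModFil hr).codRestrict
    (GM.grade γ) fun _ => GM.σ_mem γ _

lemma coe_component {γ : Γ} (r : ℛ γ) :
    (GM.component γ r : N) = GM.σ γ ⟨q r, apply_mem_quotModFil r.2⟩ := rfl

lemma component_surjective (γ : Γ) : Surjective (GM.component γ) := by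
  rintro ⟨y, hy⟩
  obtain ⟨⟨_, f, hf, rfl⟩, rfl⟩ := GM.σ_surj γ y hy
  rw [SetLike.mem_coe, gradeFil_eq_sup, Submodule.mem_sup] at hf
  obtain ⟨r, hr, g, hg, rfl⟩ := hf
  refine ⟨⟨r, hr⟩, Subtype.ext ?_⟩
  rw [coe_component, ← sub_eq_zero, ← map_sub, GM.σ_ker, quotModFilStar_eq_map]
  exact ⟨-g, neg_mem hg, by simp⟩

/-- The `K`-linear map `R → G(M)` sending `r ∈ R_γ` to the class of `q r`. -/
noncomputable def ofGradedLinear (hgr : IsAlgGrading K Γ ℛ) : R →ₗ[K] N :=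
  DirectSum.coeLinearMap GM.grade ∘ₗ DirectSum.lmap GM.component ∘ₗ
    (LinearEquiv.ofBijective (DirectSum.coeLinearMap ℛ) hgr.internal).symm.toLinearMap

lemma ofGradedLinear_coeLinearMap (hgr : IsAlgGrading K Γ ℛ) (d : DirectSum Γ fun γ => ℛ γ) :
    GM.ofGradedLinear hgr (DirectSum.coeLinearMap ℛ d) =
      DirectSum.coeLinearMap GM.grade (DirectSum.lmap GM.component d) := by
  have h : (LinearEquiv.ofBijective (DirectSum.coeLinearMap ℛ) hgr.internal).symm
      (DirectSum.coeLinearMap ℛ d) = d := LinearEquiv.symm_apply_apply _ d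
  simp only [ofGradedLinear, LinearMap.comp_apply, LinearEquiv.coe_coe, h]

lemma ofGradedLinear_of_mem (hgr : IsAlgGrading K Γ ℛ) {γ : Γ} {r : R} (hr : r ∈ ℛ γ) :
    GM.ofGradedLinear hgr r = GM.σ γ ⟨q r, apply_mem_quotModFil hr⟩ := by
  have h := GM.ofGradedLinear_coeLinearMap hgr (DirectSum.lof K Γ (fun γ => ℛ γ) γ ⟨r, hr⟩)
  simpa only [DirectSum.lmap_lof, DirectSum.coeLinearMap_lof, coe_component] using h

lemma ofGradedLinear_mul (hgr : IsAlgGrading K Γ ℛ) (r s : R) :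
    GM.ofGradedLinear hgr (r * s) = r • GM.ofGradedLinear hgr s := by
  have hr : r ∈ ⨆ γ, ℛ γ := hgr.iSup_eq_top ▸ Submodule.mem_top
  have hs : s ∈ ⨆ γ, ℛ γ := hgr.iSup_eq_top ▸ Submodule.mem_top
  induction hr using Submodule.iSup_induction' with
  | zero => simp
  | add r₁ r₂ _ _ h₁ h₂ => rw [add_mul, map_add, h₁, h₂, add_smul]
  | mem γ₁ r hr =>
    induction hs using Submodule.iSup_induction' with
    | zero => simp
    | add s₁ s₂ _ _ h₁ h₂ => rw [mul_add, map_add, map_add, h₁, h₂, smul_add]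
    | mem γ₂ s hs =>
      have h : r • q s ∈ quotModFil K Γ ℛ q (γ₁ * γ₂) := by
        rw [← map_smul]
        exact apply_mem_quotModFil (hgr.mul_mem hr hs)
      rw [GM.ofGradedLinear_of_mem hgr (hgr.mul_mem hr hs), GM.ofGradedLinear_of_mem hgr hs,
        GM.σ_smul r hr _ h]
      congr 2
      exact map_smul q r s

/-- The `R`-linear map `R → G(M)` sending `r ∈ R_γ` to the class of `q r`. -/
noncomputable def ofGraded (hgr : IsAlgGrading K Γ ℛ) : R →ₗ[R] N where
  toFun := GM.ofGradedLinear hgr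
  map_add' := map_add _
  map_smul' := GM.ofGradedLinear_mul hgr

lemma ofGraded_of_mem (hgr : IsAlgGrading K Γ ℛ) {γ : Γ} {r : R} (hr : r ∈ ℛ γ) :
    GM.ofGraded hgr r = GM.σ γ ⟨q r, apply_mem_quotModFil hr⟩ :=
  GM.ofGradedLinear_of_mem hgr hr

lemma ofGraded_surjective (hgr : IsAlgGrading K Γ ℛ) : Surjective (GM.ofGraded hgr) :=
  GM.internal.2.comp <| (DirectSum.lmap_surjective _).2 GM.component_surjective |>.comp
    (LinearEquiv.surjective _)

lemma map_ofGraded (hgr : IsAlgGrading K Γ ℛ) (γ : Γ) :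
    (ℛ γ).map ((GM.ofGraded hgr).restrictScalars K) = GM.grade γ := by
  refine le_antisymm ?_ fun y hy => ?_
  · rintro _ ⟨r, hr, rfl⟩
    rw [LinearMap.restrictScalars_apply, GM.ofGraded_of_mem hgr hr]
    exact GM.σ_mem γ _
  · obtain ⟨r, hr⟩ := GM.component_surjective γ ⟨y, hy⟩
    exact ⟨r, r.2, (GM.ofGraded_of_mem hgr r.2).trans (congrArg Subtype.val hr)⟩

lemma ker_ofGraded (hgr : IsAlgGrading K Γ ℛ) {L : Submodule R R}
    (hker : ∀ x : R, q x = 0 ↔ x ∈ L) :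
    LinearMap.ker (GM.ofGraded hgr) = Submodule.span R (HTset K Γ ℛ (L : Set R)) := by
  apply le_antisymm
  · intro x hx
    obtain ⟨d, rfl⟩ := hgr.internal.2 x
    have hd : DirectSum.lmap GM.component d = 0 := by
      apply GM.internal.1
      rw [map_zero]
      exact (GM.ofGradedLinear_coeLinearMap hgr d).symm.trans hx
    classical
    change DirectSum.coeLinearMap ℛ d ∈ _
    rw [DirectSum.coeLinearMap_eq_dfinsuppSum]
    refine sum_mem fun γ _ => ?_
    have hγ : GM.component γ (d γ) = 0 := by
      rw [← DirectSum.lmap_apply, hd, DirectSum.zero_apply]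
    have h := (GM.σ_ker γ _).1 ((GM.coe_component (d γ)).symm.trans (congrArg Subtype.val hγ))
    rcases (mem_quotModFilStar_iff hker (d γ).2).1 h with h0 | ⟨f, hf, hHT⟩
    · beta_reduce
      rw [h0]
      exact zero_mem _
    · exact Submodule.subset_span ⟨f, hf, γ, hHT⟩
  · rw [Submodule.span_le]
    rintro h ⟨f, hf, γ, hHT⟩
    rw [SetLike.mem_coe, LinearMap.mem_ker, GM.ofGraded_of_mem hgr hHT.1, GM.σ_ker]
    exact (mem_quotModFilStar_iff hker hHT.1).2 (.inr ⟨f, hf, hHT⟩)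

end AssocGradedQuotMod

end Helpers

theorem statement2 [DecidableEq Γ]
    [CovariantClass Γ Γ (· * ·) (· < ·)] [CovariantClass Γ Γ (swap (· * ·)) (· < ·)]
    (hgr : IsAlgGrading K Γ ℛ)
    -- L an arbitrary left ideal of R
    (L : Submodule R R)
    -- M = R/L, presented by a surjective R-linear map q with kernel L
    (M : Type x) [AddCommGroup M] [Module K M] [Module R M] [IsScalarTower K R M]
    (q : R →ₗ[R] M) (hq : Surjective q) (hker : ∀ x : R, q x = 0 ↔ x ∈ L)
    -- G(M), the associated Γ-graded module of M w.r.t. the induced filtration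
    (N : Type*) [AddCommGroup N] [Module K N] [Module R N] [IsScalarTower K R N]
    (GM : AssocGradedQuotMod K Γ ℛ q N) :
    ∃ φ : R →ₗ[R] N,
      -- φ is an epimorphism of Γ-graded R-modules
      Surjective φ ∧
      (∀ γ : Γ, (ℛ γ).map (φ.restrictScalars K) = GM.grade γ) ∧
      -- on each R_γ, φ sends r to the class σ_γ(q r)
      (∀ (γ : Γ) (r : R), r ∈ ℛ γ → ∀ h : q r ∈ quotModFil K Γ ℛ q γ,
        φ r = GM.σ γ ⟨q r, h⟩) ∧
      -- Ker φ = ⟨HT(L)], the graded left ideal generated by HT(L)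
      (∀ x : R, φ x = 0 ↔ x ∈ Submodule.span R (HTset K Γ ℛ (L : Set R))) := by
  exact ⟨GM.ofGraded hgr, GM.ofGraded_surjective hgr, GM.map_ofGraded hgr,
    fun _ _ hr _ => GM.ofGraded_of_mem hgr hr,
    fun x => by rw [← GM.ker_ofGraded hgr hker, LinearMap.mem_ker]⟩
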